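/- Let α ∈ ℝ. The following are equivalent: (i) (p_{n+1}(α))_{n≥0} is a Stieltjes moment sequence; (ii) φ_α is completely monotonic on (0,∞); (iii) 0 ≤ α ≤ 1. Moreover, if these hold, then the representing measure σ_α in (i) is supported by [0,1], so (p_{n+1}(α))_{n≥0} is a Hausdorff moment sequence. -/

import Mathlib

open MeasureTheory Filter Set Asymptotics

/-- The sequence of polynomials `p_n(α)` defined by `p_0(α) = 1` and
`p_{n+1}(α) = (α/(n+1)) · Σ_{k=0}^{n} ((k+1)/(k+2)) p_{n−k}(α)`. -/
noncomputable def bmpP {K : Type*} [Field K] (α : K) : ℕ → K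
  | 0 => 1
  | n + 1 => (α / (n + 1)) * ∑ k ∈ Finset.range (n + 1), ((k + 1 : K) / (k + 2)) * bmpP α (n - k)
  decreasing_by exact Nat.lt_succ_of_le (Nat.sub_le n k)

/-- The real function `φ_α(s) = e^α Σ_{n≥0} (−1)^n p_{n+1}(α) s^n/n!` for real `α`. -/
noncomputable def bmpPhiR (α s : ℝ) : ℝ :=
  Real.exp α * ∑' n : ℕ, (-1) ^ n * bmpP α (n + 1) * s ^ n / n.factorial

/-- A function `f : (0,∞) → ℝ` is completely monotonic. -/
def CompletelyMonotonicOn (f : ℝ → ℝ) : Prop :=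
  ContDiffOn ℝ (⊤ : ℕ∞) f (Set.Ioi 0) ∧
    ∀ (n : ℕ), ∀ x ∈ Set.Ioi (0 : ℝ), 0 ≤ (-1 : ℝ) ^ n * iteratedDerivWithin n f (Set.Ioi 0) x

/-- A Stieltjes moment sequence: `s n = ∫ x^n dσ(x)` for a positive measure `σ` on `[0,∞)`. -/
def IsStieltjesMoment (s : ℕ → ℝ) : Prop :=
  ∃ σ : MeasureTheory.Measure ℝ, σ (Set.Iio 0) = 0 ∧
    ∀ n : ℕ, MeasureTheory.Integrable (fun x : ℝ => x ^ n) σ ∧ s n = ∫ x, x ^ n ∂σ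

open Topology

theorem bmpP_zero (α : ℝ) : bmpP α 0 = 1 := by
  rw [bmpP]

theorem bmpP_succ (α : ℝ) (n : ℕ) : bmpP α (n + 1) =
    (α / (n + 1)) * ∑ k ∈ Finset.range (n + 1), ((k + 1 : ℝ) / (k + 2)) * bmpP α (n - k) := by
  rw [bmpP]

theorem bmpP_one (α : ℝ) : bmpP α 1 = α / 2 := by
  rw [bmpP_succ]
  simp [bmpP_zero]
  ring

theorem abs_bmpP_le_choose (α : ℝ) {N : ℕ} (hN : |α| ≤ N) (n : ℕ) :
    |bmpP α n| ≤ ((n + N).choose N : ℝ) := by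
  induction n using Nat.strong_induction_on with
  | _ n ih =>
    rcases n with _ | n
    · simp [bmpP_zero]
    have hsum : |∑ k ∈ Finset.range (n + 1), ((k + 1 : ℝ) / (k + 2)) * bmpP α (n - k)| ≤
        ((n + N + 1).choose (N + 1) : ℝ) := by
      rw [← Nat.sum_range_add_choose, ← Finset.sum_range_reflect (fun i => (i + N).choose N)]
      push_cast
      refine (Finset.abs_sum_le_sum_abs _ _).trans (Finset.sum_le_sum fun k hk => ?_)
      have h1 : |((k + 1 : ℝ) / (k + 2))| ≤ 1 := by
        rw [abs_of_nonneg (by positivity), div_le_one (by positivity)]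
        linarith
      rw [abs_mul]
      calc _ ≤ 1 * |bmpP α (n - k)| := by gcongr
        _ ≤ _ := by
          rw [one_mul]
          simpa using ih (n - k) (by omega)
    have hchoose : ((n + N + 1).choose (N + 1) : ℝ) * (N + 1) =
        ((n + 1 + N).choose N : ℝ) * (n + 1) := by
      have := Nat.choose_succ_right_eq (n + N + 1) N
      rw [show n + N + 1 - N = n + 1 by omega, show n + N + 1 = n + 1 + N by omega] at this
      rw [show n + N + 1 = n + 1 + N by omega]
      exact_mod_cast this
    rw [bmpP_succ, abs_mul, abs_div, abs_of_pos (by positivity : (0 : ℝ) < n + 1),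
      div_mul_eq_mul_div, div_le_iff₀ (by positivity), ← hchoose, mul_comm]
    gcongr
    linarith

theorem exists_abs_bmpP_le_geometric (α : ℝ) {ρ : ℝ} (hρ : 1 < ρ) :
    ∃ C, 0 ≤ C ∧ ∀ n, |bmpP α n| ≤ C * ρ ^ n := by
  obtain ⟨N, hN⟩ := exists_nat_ge |α|
  have hs : Summable fun n : ℕ => ((n + N).choose N : ℝ) * (ρ⁻¹) ^ n :=
    summable_choose_mul_geometric_of_norm_lt_one N (by
      rw [Real.norm_of_nonneg (by positivity)]
      exact inv_lt_one_of_one_lt₀ hρ)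
  refine ⟨∑' n : ℕ, ((n + N).choose N : ℝ) * (ρ⁻¹) ^ n, tsum_nonneg fun n => by positivity,
    fun n => (abs_bmpP_le_choose α hN n).trans ?_⟩
  have h := hs.le_tsum n fun j _ => by positivity
  calc ((n + N).choose N : ℝ) = ((n + N).choose N : ℝ) * (ρ⁻¹) ^ n * ρ ^ n := by
        rw [mul_assoc, ← mul_pow, inv_mul_cancel₀ (by positivity), one_pow, mul_one]
    _ ≤ _ := by gcongr

theorem le_one_of_bmpP_antitone {α : ℝ} (hα : 0 < α)
    (hanti : ∀ n, bmpP α (n + 2) ≤ bmpP α (n + 1)) : α ≤ 1 := by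
  have hpos : ∀ n, 0 < bmpP α n := by
    intro n
    induction n using Nat.strong_induction_on with
    | _ n ih =>
      rcases n with _ | n
      · simp [bmpP_zero]
      rw [bmpP_succ]
      refine mul_pos (by positivity) (Finset.sum_pos (fun k hk => ?_) (by simp))
      exact mul_pos (by positivity) (ih _ (by omega))
  have hmono : Antitone fun n => bmpP α (n + 1) := antitone_nat_of_succ_le hanti
  have hkey : ∀ n : ℕ, α * ∑ k ∈ Finset.range n, ((k + 1 : ℝ) / (k + 2)) ≤ n + 1 := by
    intro n
    have h1 : (∑ k ∈ Finset.range n, ((k + 1 : ℝ) / (k + 2))) * bmpP α (n + 1) ≤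
        ∑ k ∈ Finset.range (n + 1), ((k + 1 : ℝ) / (k + 2)) * bmpP α (n - k) := by
      rw [Finset.sum_range_succ, Finset.sum_mul]
      refine (Finset.sum_le_sum fun k hk => ?_).trans
        (le_add_of_nonneg_right (mul_nonneg (by positivity) (hpos _).le))
      have hk' := Finset.mem_range.1 hk
      have := hmono (show n - k - 1 ≤ n by omega)
      simp only [show n - k - 1 + 1 = n - k by omega] at this
      gcongr
    have h2 : bmpP α (n + 1) * (n + 1) = α *
        ∑ k ∈ Finset.range (n + 1), ((k + 1 : ℝ) / (k + 2)) * bmpP α (n - k) := by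
      rw [bmpP_succ]
      field_simp
    have h3 := mul_le_mul_of_nonneg_left h1 hα.le
    rw [← h2, ← mul_assoc, mul_comm (bmpP α (n + 1))] at h3
    exact le_of_mul_le_mul_right h3 (hpos _)
  have hlim : Tendsto (fun k : ℕ => ((k + 1 : ℝ) / (k + 2))) atTop (𝓝 1) := by
    have := (tendsto_natCast_div_add_atTop (1 : ℝ)).comp (tendsto_add_atTop_nat 1)
    refine this.congr fun k => ?_
    simp only [Function.comp_apply]
    push_cast
    ring_nf
  have hlim2 : Tendsto (fun n : ℕ => (n : ℝ)⁻¹ * ((n : ℝ) + 1)) atTop (𝓝 1) := by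
    have : Tendsto (fun n : ℕ => 1 + (n : ℝ)⁻¹) atTop (𝓝 (1 + 0)) :=
      tendsto_const_nhds.add tendsto_inv_atTop_nhds_zero_nat
    rw [add_zero] at this
    refine this.congr' ?_
    filter_upwards [eventually_gt_atTop 0] with n hn
    field_simp
  have := le_of_tendsto_of_tendsto' (hlim.cesaro.const_mul α) hlim2 fun n => by
    rw [mul_left_comm]
    exact mul_le_mul_of_nonneg_left (hkey n) (by positivity)
  simpa using this

/-- The alternating exponential generating function of a sequence. -/
noncomputable def altExp (a : ℕ → ℝ) (s : ℝ) : ℝ :=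
  ∑' k : ℕ, (-1) ^ k * a k * s ^ k / k.factorial

theorem altExp_zero (a : ℕ → ℝ) : altExp a 0 = a 0 := by
  rw [altExp, tsum_eq_single 0]
  · simp
  · intro k hk
    simp [hk]

section AltExp

variable {a : ℕ → ℝ} {C ρ : ℝ}

theorem summable_geometric_mul_pow_div_factorial (C ρ s : ℝ) :
    Summable fun k : ℕ => C * ρ ^ k * s ^ k / k.factorial := by
  refine ((Real.summable_pow_div_factorial (ρ * s)).mul_left C).congr fun k => ?_
  rw [mul_pow]
  ring

theorem abs_altExp_term_le (ha : ∀ n, |a n| ≤ C * ρ ^ n) (s : ℝ) (k : ℕ) :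
    ‖(-1) ^ k * a k * s ^ k / k.factorial‖ ≤ C * ρ ^ k * |s| ^ k / k.factorial := by
  rw [Real.norm_eq_abs, abs_div, abs_mul, abs_mul, abs_pow, abs_pow, abs_neg, abs_one, one_pow,
    one_mul, Nat.abs_cast]
  gcongr
  exact ha k

theorem summable_altExp_term (ha : ∀ n, |a n| ≤ C * ρ ^ n) (s : ℝ) :
    Summable fun k : ℕ => (-1) ^ k * a k * s ^ k / k.factorial :=
  .of_norm_bounded (summable_geometric_mul_pow_div_factorial C ρ |s|) (abs_altExp_term_le ha s)

theorem altExp_le (ha : ∀ n, |a n| ≤ C * ρ ^ n) (s : ℝ) :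
    altExp a s ≤ C * Real.exp (ρ * |s|) := by
  have h : HasSum (fun k : ℕ => C * ρ ^ k * |s| ^ k / k.factorial) (C * Real.exp (ρ * |s|)) := by
    rw [Real.exp_eq_exp_ℝ]
    refine ((NormedSpace.expSeries_div_hasSum_exp (ρ * |s|)).mul_left C).congr_fun fun k => ?_
    rw [mul_pow]
    ring
  exact hasSum_le (fun k => (le_abs_self _).trans (abs_altExp_term_le ha s k))
    (summable_altExp_term ha s).hasSum h

theorem hasDerivAt_altExp (ha : ∀ n, |a n| ≤ C * ρ ^ n) (s : ℝ) :
    HasDerivAt (altExp a) (-altExp (fun k => a (k + 1)) s) s := by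
  set R := |s| + 1 with hR
  have hR0 : 0 ≤ R := by positivity
  let u : ℕ → ℝ := fun k => C * ρ ^ k * (k * R ^ (k - 1)) / k.factorial
  let g' : ℕ → ℝ → ℝ := fun k y => (-1) ^ k * a k * (k * y ^ (k - 1)) / k.factorial
  have hu : Summable u := by
    rw [← summable_nat_add_iff 1]
    refine (summable_geometric_mul_pow_div_factorial (C * ρ) ρ R).congr fun k => ?_
    simp only [u, Nat.factorial_succ]
    push_cast
    field_simp
    simp [pow_succ]
    ring
  have hbound : ∀ k, ∀ y ∈ Metric.ball (0 : ℝ) R, ‖g' k y‖ ≤ u k := by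
    intro k y hy
    have hy' : |y| ≤ R := by simpa using (Metric.mem_ball.1 hy).le
    simp only [g', u]
    rw [Real.norm_eq_abs, abs_div, abs_mul, abs_mul, abs_mul, abs_pow, abs_pow, abs_neg, abs_one,
      one_pow, one_mul, Nat.abs_cast, Nat.abs_cast]
    have := ha k
    have h0 : 0 ≤ C * ρ ^ k := (abs_nonneg _).trans this
    gcongr
  have hs : s ∈ Metric.ball (0 : ℝ) R := by simp [hR]
  have hd := hasDerivAt_tsum_of_isPreconnected (y := s) (y₀ := s)
    (g := fun k y => (-1) ^ k * a k * y ^ k / k.factorial) (g' := g') hu Metric.isOpen_ball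
    (convex_ball (0 : ℝ) R).isPreconnected
    (fun k y _ => ((hasDerivAt_pow k y).const_mul _).div_const _) hbound hs
    (summable_altExp_term ha s) hs
  have hsum : Summable fun k => g' k s := .of_norm_bounded hu fun k => hbound k s hs
  convert! hd using 1
  rw [hsum.tsum_eq_zero_add, altExp, ← tsum_neg]
  simp only [g', Nat.cast_zero, zero_mul, mul_zero, zero_div, zero_add]
  refine tsum_congr fun k => ?_
  simp only [Nat.factorial_succ, Nat.add_sub_cancel]
  push_cast
  field_simp
  ring

end AltExp

theorem iteratedDeriv_const_mul_of_hasDerivAt_neg {G : ℕ → ℝ → ℝ}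
    (hG : ∀ n s, HasDerivAt (G n) (-G (n + 1) s) s) (c : ℝ) (n : ℕ) :
    iteratedDeriv n (fun s => c * G 0 s) = fun s => (-1) ^ n * (c * G n s) := by
  induction n with
  | zero => simp
  | succ n ih =>
    rw [iteratedDeriv_succ, ih]
    ext s
    rw [(((hG n s).const_mul c).const_mul _).deriv]
    ring

theorem completelyMonotonicOn_const_mul_iff {G : ℕ → ℝ → ℝ}
    (hG : ∀ n s, HasDerivAt (G n) (-G (n + 1) s) s) {c : ℝ} (hc : 0 < c) :
    CompletelyMonotonicOn (fun s => c * G 0 s) ↔ ∀ n s, 0 < s → 0 ≤ G n s := by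
  have key : ∀ n, ∀ x ∈ Ioi (0 : ℝ),
      (-1 : ℝ) ^ n * iteratedDerivWithin n (fun s => c * G 0 s) (Ioi 0) x = c * G n x := by
    intro n x hx
    rw [iteratedDerivWithin_of_isOpen isOpen_Ioi hx, iteratedDeriv_const_mul_of_hasDerivAt_neg hG,
      ← mul_assoc, ← mul_pow]
    simp
  constructor
  · rintro ⟨-, h⟩ n s hs
    have := h n s hs
    rw [key n s hs] at this
    exact nonneg_of_mul_nonneg_right this hc
  · intro h
    refine ⟨ContDiff.contDiffOn (contDiff_of_differentiable_iteratedDeriv fun n _ => ?_),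
      fun n x hx => ?_⟩
    · rw [iteratedDeriv_const_mul_of_hasDerivAt_neg hG]
      exact fun s => (((hG n s).const_mul c).const_mul _).differentiableAt
    · rw [key n x hx]
      exact mul_nonneg hc.le (h n x hx)

theorem sq_le_mul_of_bernstein_nonneg (L : Polynomial ℝ →ₗ[ℝ] ℝ)
    (hL : ∀ i m : ℕ, 0 ≤ L (Polynomial.X ^ i * (1 - Polynomial.X) ^ m)) :
    (L Polynomial.X) ^ 2 ≤ L 1 * L (Polynomial.X ^ 2) := by
  have hw : ∀ n ν, 0 ≤ L (bernsteinPolynomial ℝ n ν) := by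
    intro n ν
    rw [bernsteinPolynomial, mul_assoc, ← nsmul_eq_mul, map_nsmul]
    exact nsmul_nonneg (hL _ _) _
  have hfin : ∀ n : ℕ, ((n : ℝ) * L Polynomial.X) ^ 2 ≤
      L 1 * ((n * (n - 1) : ℕ) * L (Polynomial.X ^ 2) + n * L Polynomial.X) := by
    intro n
    have h0 := congrArg L (bernsteinPolynomial.sum ℝ n)
    have h1 := congrArg L (bernsteinPolynomial.sum_smul ℝ n)
    have h2 := congrArg L (bernsteinPolynomial.sum_mul_smul ℝ n)
    simp only [map_sum, map_nsmul] at h0 h1 h2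
    simp only [nsmul_eq_mul] at h1 h2
    rw [← h0, ← h1, ← h2, ← Finset.sum_add_distrib]
    have := Finset.sum_sq_le_sum_mul_sum_of_sq_le_mul (Finset.range (n + 1))
      (r := fun ν => (ν : ℝ) * L (bernsteinPolynomial ℝ n ν))
      (f := fun ν => L (bernsteinPolynomial ℝ n ν))
      (g := fun ν => ((ν * (ν - 1) : ℕ) : ℝ) * L (bernsteinPolynomial ℝ n ν) +
        ν * L (bernsteinPolynomial ℝ n ν))
      (fun ν _ => hw n ν) (fun ν _ => by have := hw n ν; positivity)
      (fun ν _ => le_of_eq (by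
        rcases ν with _ | ν
        · simp
        · push_cast [Nat.add_sub_cancel]
          ring))
    exact this
  have hlim : Tendsto (fun n : ℕ => L 1 * ((1 - ((n : ℝ))⁻¹) * L (Polynomial.X ^ 2) +
      ((n : ℝ))⁻¹ * L Polynomial.X)) atTop
      (𝓝 (L 1 * ((1 - 0) * L (Polynomial.X ^ 2) + 0 * L Polynomial.X))) := by
    have := tendsto_inv_atTop_nhds_zero_nat (𝕜 := ℝ)
    exact (((tendsto_const_nhds.sub this).mul_const _).add (this.mul_const _)).const_mul _
  have := ge_of_tendsto hlim (b := (L Polynomial.X) ^ 2) (by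
    filter_upwards [eventually_gt_atTop 0] with n hn
    have h := hfin n
    have hn' : (0 : ℝ) < n := by exact_mod_cast hn
    rw [Nat.cast_mul, Nat.cast_sub (by omega : 1 ≤ n)] at h
    refine le_of_mul_le_mul_left (a := (n : ℝ) ^ 2) ?_ (by positivity)
    calc _ = ((n : ℝ) * L Polynomial.X) ^ 2 := by ring
      _ ≤ _ := h
      _ = _ := by
        field_simp
        push_cast
        ring)
  simpa using this

/-- The linear functional on polynomials sending `X ^ j` to `u j`. -/
noncomputable def momentFunctional (u : ℕ → ℝ) : Polynomial ℝ →ₗ[ℝ] ℝ :=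
  (Polynomial.basisMonomials ℝ).constr ℝ u

theorem momentFunctional_X_pow (u : ℕ → ℝ) (j : ℕ) :
    momentFunctional u (Polynomial.X ^ j) = u j := by
  have := (Polynomial.basisMonomials ℝ).constr_basis ℝ u j
  simpa only [momentFunctional, Polynomial.coe_basisMonomials, ← Polynomial.X_pow_eq_monomial] using this

theorem momentFunctional_mul_one_sub_X (u : ℕ → ℝ) (q : Polynomial ℝ) :
    momentFunctional u (q * (1 - Polynomial.X)) =
      momentFunctional (fun j => u j - u (j + 1)) q := by
  induction q using Polynomial.induction_on' with
  | add p q hp hq => rw [add_mul, map_add, map_add, hp, hq]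
  | monomial n c =>
    rw [← Polynomial.C_mul_X_pow_eq_monomial, mul_assoc, ← Polynomial.smul_eq_C_mul,
      ← Polynomial.smul_eq_C_mul, map_smul, map_smul, mul_sub, mul_one, ← pow_succ, map_sub]
    simp only [momentFunctional_X_pow]

theorem momentFunctional_nonneg {G : ℕ → ℝ → ℝ}
    (hG : ∀ n s, HasDerivAt (G n) (-G (n + 1) s) s) (hpos : ∀ n s, 0 ≤ G n s)
    {h : ℝ} (hh : 0 ≤ h) (x : ℝ) (i m : ℕ) :
    0 ≤ momentFunctional (fun j => G 0 (x + j * h))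
      (Polynomial.X ^ i * (1 - Polynomial.X) ^ m) := by
  induction m generalizing G with
  | zero => simpa [momentFunctional_X_pow] using hpos 0 _
  | succ m ih =>
    rw [pow_succ, ← mul_assoc, momentFunctional_mul_one_sub_X]
    have := ih (G := fun n s => G n s - G n (s + h)) (fun n s => by
        convert! (hG n s).sub ((hG n (s + h)).comp_add_const s h) using 1
        ring) (fun n s => by
        have hanti : Antitone (G n) := antitone_of_deriv_nonpos
          (fun s => (hG n s).differentiableAt) (fun s => by
            rw [(hG n s).deriv]
            exact neg_nonpos.2 (hpos _ _))
        exact sub_nonneg.2 (hanti (by linarith)))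
    convert! this using 4 with j
    push_cast
    ring_nf

theorem sq_le_mul_of_completelyMonotone {G : ℕ → ℝ → ℝ}
    (hG : ∀ n s, HasDerivAt (G n) (-G (n + 1) s) s) (hpos : ∀ n s, 0 ≤ G n s)
    {h : ℝ} (hh : 0 ≤ h) (x : ℝ) :
    (G 0 (x + h)) ^ 2 ≤ G 0 x * G 0 (x + 2 * h) := by
  have := sq_le_mul_of_bernstein_nonneg _ (momentFunctional_nonneg hG hpos hh x)
  rw [← pow_zero Polynomial.X, momentFunctional_X_pow, momentFunctional_X_pow] at this
  nth_rw 1 [← pow_one Polynomial.X] at this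
  rw [momentFunctional_X_pow] at this
  simpa using this

theorem le_mul_of_logConvex {u : ℕ → ℝ} (hu : ∀ j, 0 ≤ u j)
    (hlc : ∀ j, u (j + 1) ^ 2 ≤ u j * u (j + 2)) {C M : ℝ} (hM : 0 < M)
    (hb : ∀ j, u j ≤ C * M ^ j) : u 1 ≤ M * u 0 := by
  by_contra! hlt
  have h0 : 0 < u 0 := by
    refine (hu 0).lt_of_ne fun h => ?_
    have := hlc 0
    rw [← h, zero_mul] at this
    have h1 : u 1 = 0 := by simpa using le_antisymm this (sq_nonneg _)
    rw [← h, h1, mul_zero] at hlt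
    exact lt_irrefl _ hlt
  set r := u 1 / u 0 with hr
  have hrM : M < r := by rwa [hr, lt_div_iff₀ h0]
  have hr0 : 0 < r := hM.trans hrM
  have hstep : ∀ j, 0 < u j ∧ r * u j ≤ u (j + 1) := by
    intro j
    induction j with
    | zero => exact ⟨h0, by rw [hr, div_mul_cancel₀ _ h0.ne']⟩
    | succ j ih =>
      have h1 : 0 < u (j + 1) := (mul_pos hr0 ih.1).trans_le ih.2
      refine ⟨h1, le_of_mul_le_mul_left ?_ ih.1⟩
      nlinarith [hlc j, mul_le_mul_of_nonneg_right ih.2 h1.le]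
  have hgeom : ∀ j, r ^ j * u 0 ≤ u j := by
    intro j
    induction j with
    | zero => simp
    | succ j ih =>
      calc _ = r * (r ^ j * u 0) := by ring
        _ ≤ r * u j := by gcongr
        _ ≤ _ := (hstep j).2
  have hbdd : ∀ j, (r / M) ^ j ≤ C / u 0 := by
    intro j
    rw [div_pow, div_le_div_iff₀ (by positivity) h0]
    exact (hgeom j).trans (hb j)
  obtain ⟨j, hj⟩ := pow_unbounded_of_one_lt (C / u 0) ((one_lt_div hM).2 hrM)
  exact (hbdd j).not_gt hj

theorem le_mul_of_completelyMonotone_of_exp_bound {G : ℕ → ℝ → ℝ}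
    (hG : ∀ n s, HasDerivAt (G n) (-G (n + 1) s) s) (hpos : ∀ n s, 0 ≤ G n s)
    {C ρ : ℝ} (hb : ∀ s, G 0 s ≤ C * Real.exp (ρ * |s|)) : G 1 0 ≤ ρ * G 0 0 := by
  have hexp : ∀ h, 0 < h → G 0 (-h) ≤ Real.exp (ρ * h) * G 0 0 := by
    intro h hh
    have := le_mul_of_logConvex (u := fun j => G 0 (-(j * h))) (C := C)
      (M := Real.exp (ρ * h)) (fun j => hpos _ _) (fun j => ?_) (Real.exp_pos _) (fun j => ?_)
    · simpa using this
    · have := sq_le_mul_of_completelyMonotone hG hpos hh.le (-((j + 2) * h))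
      rw [mul_comm (G 0 _)] at this
      convert! this using 3 <;> push_cast <;> ring_nf
    · refine (hb _).trans_eq ?_
      rw [abs_neg, abs_of_nonneg (by positivity), ← Real.exp_nat_mul]
      ring_nf
  have hd : HasDerivAt (fun h => Real.exp (ρ * h) * G 0 0 - G 0 (-h)) (ρ * G 0 0 - G 1 0) 0 := by
    have h1 : HasDerivAt (fun h => Real.exp (ρ * h)) (Real.exp (ρ * 0) * (ρ * 1)) 0 :=
      ((hasDerivAt_id (0 : ℝ)).const_mul ρ).exp
    have h2 : HasDerivAt (fun h => G 0 (-h)) (-G 1 (-0) * -1) 0 :=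
      HasDerivAt.comp (0 : ℝ) (hG 0 (-0)) (hasDerivAt_neg 0)
    convert! (h1.mul_const (G 0 0)).sub h2 using 1
    simp
  have := ge_of_tendsto hd.tendsto_slope_zero_right (b := 0) (by
    filter_upwards [self_mem_nhdsWithin] with h hh
    have hh' : 0 < h := hh
    simp only [zero_add, mul_zero, Real.exp_zero, one_mul, neg_zero, sub_self, sub_zero,
      smul_eq_mul]
    exact mul_nonneg (by positivity) (sub_nonneg.2 (hexp h hh')))
  linarith

/-- The power series of `1 / (1 - b z)`. -/
noncomputable def geomSeries (b : ℝ) : PowerSeries ℝ :=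
  PowerSeries.mk fun n => b ^ n

theorem one_sub_mul_geomSeries (b : ℝ) :
    (1 - PowerSeries.C b * PowerSeries.X) * geomSeries b = 1 := by
  ext n
  rcases n with _ | n
  · simp [geomSeries, sub_mul, mul_assoc]
  · rw [sub_mul, one_mul, mul_assoc, map_sub, PowerSeries.coeff_C_mul, PowerSeries.coeff_succ_X_mul]
    simp [geomSeries, PowerSeries.coeff_one, pow_succ']

theorem derivative_geomSeries (b : ℝ) :
    PowerSeries.derivative ℝ (geomSeries b) = PowerSeries.C b * geomSeries b ^ 2 := by
  have h := one_sub_mul_geomSeries b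
  have hd := congrArg (PowerSeries.derivative ℝ) h
  simp only [Derivation.leibniz, map_sub, Derivation.map_one_eq_zero, smul_eq_mul,
    PowerSeries.derivative_C, PowerSeries.derivative_X] at hd
  linear_combination -PowerSeries.derivative ℝ (geomSeries b) * h + geomSeries b * hd

/-- The power series of `∏ (1 - a i z) / (1 - b i z)` over `i < n`. -/
noncomputable def ratioProd (a b : ℕ → ℝ) (n : ℕ) : PowerSeries ℝ :=
  ∏ i ∈ Finset.range n, (1 - PowerSeries.C (a i) * PowerSeries.X) * geomSeries (b i)

theorem derivative_ratioProd (a b : ℕ → ℝ) (n : ℕ) :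
    PowerSeries.derivative ℝ (ratioProd a b n) = ratioProd a b n *
      ∑ i ∈ Finset.range n, (PowerSeries.C (b i) * geomSeries (b i) -
        PowerSeries.C (a i) * geomSeries (a i)) := by
  induction n with
  | zero => simp [ratioProd]
  | succ n ih =>
    have hs : ratioProd a b (n + 1) = ratioProd a b n *
        ((1 - PowerSeries.C (a n) * PowerSeries.X) * geomSeries (b n)) :=
      Finset.prod_range_succ _ _
    rw [hs, Finset.sum_range_succ]
    simp only [Derivation.leibniz, map_sub, Derivation.map_one_eq_zero, smul_eq_mul, ih,
      derivative_geomSeries, PowerSeries.derivative_C, PowerSeries.derivative_X]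
    linear_combination (ratioProd a b n * geomSeries (b n) * PowerSeries.C (a n)) *
      one_sub_mul_geomSeries (a n)

theorem coeff_ratioProd_zero (a b : ℕ → ℝ) (n : ℕ) :
    PowerSeries.coeff 0 (ratioProd a b n) = 1 := by
  rw [PowerSeries.coeff_zero_eq_constantCoeff_apply, ratioProd, map_prod]
  refine Finset.prod_eq_one fun i _ => ?_
  simp [geomSeries]

theorem coeff_ratioProd_succ (a b : ℕ → ℝ) (n m : ℕ) :
    PowerSeries.coeff (m + 1) (ratioProd a b n) = (1 / (m + 1)) *
      ∑ k ∈ Finset.range (m + 1), (∑ i ∈ Finset.range n, (b i ^ (k + 1) - a i ^ (k + 1))) *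
        PowerSeries.coeff (m - k) (ratioProd a b n) := by
  have h := congrArg (PowerSeries.coeff m) (derivative_ratioProd a b n)
  rw [PowerSeries.coeff_derivative, mul_comm (ratioProd a b n), PowerSeries.coeff_mul,
    Finset.Nat.sum_antidiagonal_eq_sum_range_succ_mk] at h
  have hc : ∀ k, PowerSeries.coeff k (∑ i ∈ Finset.range n, (PowerSeries.C (b i) *
      geomSeries (b i) - PowerSeries.C (a i) * geomSeries (a i))) =
      ∑ i ∈ Finset.range n, (b i ^ (k + 1) - a i ^ (k + 1)) := by
    intro k
    simp [geomSeries, pow_succ']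
  simp only [hc] at h
  rw [← h]
  field_simp

theorem exists_ratioProd_eq {a b : ℕ → ℝ} {n : ℕ} (hab : ∀ i < n, a i ≤ b i)
    (hba : ∀ i < n, ∀ j < i, b j ≤ a i) (hb : StrictMono b) :
    ∃ c : ℕ → ℝ, (∀ i, 0 ≤ c i) ∧ ratioProd a b n =
      1 + PowerSeries.X * ∑ i ∈ Finset.range n, PowerSeries.C (c i) * geomSeries (b i) := by
  induction n with
  | zero => exact ⟨0, fun _ => le_rfl, by simp [ratioProd]⟩
  | succ n ih =>
    obtain ⟨c, hc, heq⟩ := ih (fun i hi => hab i (by omega)) (fun i hi => hba i (by omega))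
    let A : ℕ → ℝ := fun i => (a n - b i) / (b n - b i)
    let B : ℕ → ℝ := fun i => (b n - a n) / (b n - b i)
    have habn := hab n (by omega)
    have hlt : ∀ i < n, 0 < b n - b i := fun i hi => sub_pos.2 (hb hi)
    let S := ∑ i ∈ Finset.range n, c i * B i
    have hS : 0 ≤ S := Finset.sum_nonneg fun i hi =>
      mul_nonneg (hc i) (div_nonneg (by linarith) (hlt i (Finset.mem_range.1 hi)).le)
    refine ⟨fun i => if i < n then c i * A i else S + (b n - a n), fun i => ?_, ?_⟩
    · dsimp only
      split_ifs with hi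
      · exact mul_nonneg (hc i) (div_nonneg (by linarith [hba n (by omega) i hi]) (hlt i hi).le)
      · linarith
    have hterm : ∀ i < n, PowerSeries.C (c i) * geomSeries (b i) *
        ((1 - PowerSeries.C (a n) * PowerSeries.X) * geomSeries (b n)) =
        PowerSeries.C (c i * A i) * geomSeries (b i) +
          PowerSeries.C (c i * B i) * geomSeries (b n) := by
      intro i hi
      have h0 := (hlt i hi).ne'
      have h1 : A i + B i = 1 := by
        simp only [A, B]
        field_simp
        ring
      have h2 : A i * b n + B i * b i = a n := by
        simp only [A, B]
        field_simp
        ring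
      have h1' := congrArg (PowerSeries.C (R := ℝ)) h1
      have h2' := congrArg (PowerSeries.C (R := ℝ)) h2
      simp only [map_add, map_mul, map_one] at h1' h2' ⊢
      have e1 := one_sub_mul_geomSeries (b i)
      have e2 := one_sub_mul_geomSeries (b n)
      linear_combination (PowerSeries.C (c i) * geomSeries (b i) * geomSeries (b n)) *
        (PowerSeries.X * h2' - h1') + PowerSeries.C (c i) * PowerSeries.C (A i) * geomSeries (b i) * e2 +
        PowerSeries.C (c i) * PowerSeries.C (B i) * geomSeries (b n) * e1
    have hlast : (1 - PowerSeries.C (a n) * PowerSeries.X) * geomSeries (b n) =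
        1 + PowerSeries.X * (PowerSeries.C (b n - a n) * geomSeries (b n)) := by
      rw [map_sub]
      linear_combination one_sub_mul_geomSeries (b n)
    have hsum : (∑ i ∈ Finset.range n, PowerSeries.C (c i) * geomSeries (b i)) *
        ((1 - PowerSeries.C (a n) * PowerSeries.X) * geomSeries (b n)) =
        ∑ i ∈ Finset.range n, PowerSeries.C (c i * A i) * geomSeries (b i) +
          PowerSeries.C S * geomSeries (b n) := by
      rw [Finset.sum_mul, map_sum, Finset.sum_mul, ← Finset.sum_add_distrib]
      exact Finset.sum_congr rfl fun i hi => hterm i (Finset.mem_range.1 hi)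
    have hs : ratioProd a b (n + 1) = ratioProd a b n *
        ((1 - PowerSeries.C (a n) * PowerSeries.X) * geomSeries (b n)) :=
      Finset.prod_range_succ _ _
    rw [hs, heq, add_mul, one_mul, mul_assoc, hsum, hlast, Finset.sum_range_succ]
    dsimp only
    have hcongr : ∑ i ∈ Finset.range n,
        PowerSeries.C (if i < n then c i * A i else S + (b n - a n)) * geomSeries (b i) =
        ∑ i ∈ Finset.range n, PowerSeries.C (c i * A i) * geomSeries (b i) :=
      Finset.sum_congr rfl fun i hi => by rw [if_pos (Finset.mem_range.1 hi)]
    rw [if_neg (lt_irrefl n), hcongr, map_add]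
    ring

theorem exists_finiteMeasure_integral_pow_eq_sum {c b : ℕ → ℝ} (s : Finset ℕ)
    (hc : ∀ i ∈ s, 0 ≤ c i) (hb : ∀ i ∈ s, b i ∈ Icc (0 : ℝ) 1) :
    ∃ μ : FiniteMeasure unitInterval, ∀ n : ℕ,
      ∫ x, (x : ℝ) ^ n ∂(μ : Measure unitInterval) = ∑ i ∈ s, c i * b i ^ n := by
  induction s using Finset.induction_on with
  | empty => exact ⟨0, by simp⟩
  | insert j s hj ih =>
    obtain ⟨μ, hμ⟩ := ih (fun i hi => hc i (Finset.mem_insert_of_mem hi))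
      (fun i hi => hb i (Finset.mem_insert_of_mem hi))
    let x : unitInterval := ⟨b j, hb j (Finset.mem_insert_self j s)⟩
    let ν : Measure unitInterval := (c j).toNNReal • Measure.dirac x
    have hintegrable : ∀ (n : ℕ) (ρ : Measure unitInterval) [IsFiniteMeasure ρ],
        Integrable (fun x : unitInterval => (x : ℝ) ^ n) ρ := by
      intro n ρ _
      exact (by fun_prop : Continuous fun x : unitInterval => (x : ℝ) ^ n).integrable_of_hasCompactSupport
        (HasCompactSupport.of_compactSpace _)
    refine ⟨⟨(μ : Measure unitInterval) + ν, inferInstance⟩, fun n => ?_⟩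
    rw [Finset.sum_insert hj, FiniteMeasure.toMeasure_mk, integral_add_measure (hintegrable n _) (hintegrable n _),
      hμ, integral_smul_nnreal_measure, integral_dirac, NNReal.smul_def,
      Real.coe_toNNReal _ (hc j (Finset.mem_insert_self j s)), add_comm, smul_eq_mul]

theorem exists_finiteMeasure_of_tendsto_moments {s : ℕ → ℕ → ℝ} {t : ℕ → ℝ}
    (hs : ∀ N, ∃ μ : FiniteMeasure unitInterval, ∀ n : ℕ,
      ∫ x, (x : ℝ) ^ n ∂(μ : Measure unitInterval) = s N n)
    (hlim : ∀ n, Tendsto (fun N => s N n) atTop (𝓝 (t n))) :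
    ∃ μ : FiniteMeasure unitInterval, ∀ n : ℕ,
      ∫ x, (x : ℝ) ^ n ∂(μ : Measure unitInterval) = t n := by
  choose μ hμ using hs
  obtain ⟨C, hC⟩ := (hlim 0).bddAbove_range
  have hmass : ∀ N, (μ N).mass ≤ C.toNNReal := by
    intro N
    have h1 := hμ N 0
    simp only [pow_zero, integral_const, smul_eq_mul, mul_one] at h1
    have h2 : s N 0 ≤ C := hC ⟨N, rfl⟩
    rw [← h1] at h2
    exact NNReal.le_toNNReal_of_coe_le h2
  let U : Ultrafilter (FiniteMeasure unitInterval) := (hyperfilter ℕ).map μ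
  obtain ⟨ν, -, hν⟩ := (isCompact_setOfPred_finiteMeasure_le_of_compactSpace unitInterval
    C.toNNReal).ultrafilter_le_nhds U (by
      rw [le_principal_iff]
      exact Eventually.of_forall (f := (hyperfilter ℕ : Filter ℕ)) hmass)
  have hT : Tendsto μ (hyperfilter ℕ) (𝓝 ν) := hν
  refine ⟨ν, fun n => ?_⟩
  have h1 := FiniteMeasure.tendsto_iff_forall_integral_tendsto.1 hT
    (BoundedContinuousFunction.mkOfCompact ⟨fun x : unitInterval => (x : ℝ) ^ n, by fun_prop⟩)
  simp only [BoundedContinuousFunction.mkOfCompact_apply, ContinuousMap.coe_mk, hμ] at h1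
  exact tendsto_nhds_unique h1 ((hlim n).mono_left Nat.hyperfilter_le_atTop)

theorem pow_succ_sub_pow_succ_bounds {x y : ℝ} (hx : 0 ≤ x) (hxy : x ≤ y) (n : ℕ) :
    (n + 1) * x ^ n * (y - x) ≤ y ^ (n + 1) - x ^ (n + 1) ∧
      y ^ (n + 1) - x ^ (n + 1) ≤ (n + 1) * y ^ n * (y - x) := by
  have hy := hx.trans hxy
  have hd := sub_nonneg.2 hxy
  induction n with
  | zero => simp
  | succ n ih =>
    have hp : x ^ (n + 1) ≤ y ^ (n + 1) := by gcongr
    push_cast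
    constructor
    · have := mul_le_mul_of_nonneg_left ih.1 hx
      have := mul_le_mul_of_nonneg_right hp hd
      simp only [pow_succ] at *
      nlinarith
    · have := mul_le_mul_of_nonneg_left ih.2 hy
      have := mul_le_mul_of_nonneg_right hp hd
      simp only [pow_succ] at *
      nlinarith

/-- Upper endpoints of the uniform partition of `[0, 1]` into `N` intervals. -/
noncomputable def gridUpper (N i : ℕ) : ℝ := (i + 1) / N

/-- Points cutting off the fraction `α i / N` from the top of the intervals of the uniform
partition. -/
noncomputable def gridLower (α : ℝ) (N i : ℕ) : ℝ := (i + 1) / N - α * i / N * (1 / N)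

theorem abs_sum_grid_sub_le {α : ℝ} (h0 : 0 ≤ α) (h1 : α ≤ 1) {N : ℕ} (hN : 0 < N) (k : ℕ) :
    |(k + 2) * ∑ i ∈ Finset.range N, (gridUpper N i ^ (k + 1) - gridLower α N i ^ (k + 1)) -
      α * (k + 1)| ≤ (k + 2) * (k + 1) * α * (1 / N) := by
  have hN' : (0 : ℝ) < N := by exact_mod_cast hN
  set h : ℝ := 1 / N with hh
  have hh0 : 0 < h := by positivity
  have hNh : N * h = 1 := by rw [hh]; field_simp
  have htel : ∀ m : ℕ, m ≠ 0 →
      ∑ i ∈ Finset.range N, (((i + 1 : ℕ) * h) ^ m - ((i : ℕ) * h) ^ m) = 1 := by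
    intro m hm
    rw [Finset.sum_range_sub (fun i : ℕ => ((i : ℝ) * h) ^ m), hNh]
    simp [hm]
  have hterm : ∀ i ∈ Finset.range N,
      |(k + 2) * (gridUpper N i ^ (k + 1) - gridLower α N i ^ (k + 1)) -
        α * (k + 1) * (((i + 1 : ℕ) * h) ^ (k + 2) - (i * h) ^ (k + 2))| ≤
      (k + 2) * (k + 1) * α * h * (((i + 1 : ℕ) * h) ^ (k + 1) - (i * h) ^ (k + 1)) := by
    intro i hi
    have hiN : (i : ℝ) + 1 ≤ N := by exact_mod_cast Finset.mem_range.1 hi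
    set x : ℝ := i * h with hx
    have hx0 : 0 ≤ x := by positivity
    have hx1 : x ≤ 1 := by
      rw [← hNh, hx]
      exact mul_le_mul_of_nonneg_right (by linarith) hh0.le
    have eU : gridUpper N i = x + h := by rw [gridUpper, hx, hh]; ring
    have eL : gridLower α N i = x + h - α * x * h := by rw [gridLower, hx, hh]; ring
    have ei : ((i + 1 : ℕ) : ℝ) * h = x + h := by push_cast; ring
    have hax : α * x ≤ 1 := mul_le_one₀ h1 hx0 hx1
    have hL : x ≤ x + h - α * x * h := by nlinarith
    have hLU : x + h - α * x * h ≤ x + h := by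
      have : 0 ≤ α * x * h := by positivity
      linarith
    rw [eU, eL, ei]
    obtain ⟨l1, u1⟩ := pow_succ_sub_pow_succ_bounds (hx0.trans hL) hLU k
    obtain ⟨l2, u2⟩ := pow_succ_sub_pow_succ_bounds hx0 (by linarith : x ≤ x + h) (k + 1)
    have l1' : (k + 1) * (α * h) * x ^ (k + 1) ≤
        (x + h) ^ (k + 1) - (x + h - α * x * h) ^ (k + 1) := by
      refine le_trans ?_ l1
      calc (k + 1) * (α * h) * x ^ (k + 1) = (k + 1) * x ^ k * (x + h - (x + h - α * x * h)) := by
            ring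
        _ ≤ _ := by gcongr
    have u1' : (x + h) ^ (k + 1) - (x + h - α * x * h) ^ (k + 1) ≤
        (k + 1) * (α * h) * (x + h) ^ (k + 1) := by
      refine u1.trans ?_
      calc (k + 1) * (x + h) ^ k * (x + h - (x + h - α * x * h)) =
            (k + 1) * (α * h) * ((x + h) ^ k * x) := by ring
        _ ≤ (k + 1) * (α * h) * ((x + h) ^ k * (x + h)) := by gcongr; linarith
        _ = _ := by ring
    push_cast at l2 u2
    rw [show k + 1 + 1 = k + 2 by ring] at l2 u2
    have hk : (0 : ℝ) ≤ k + 2 := by positivity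
    have hk' : (0 : ℝ) ≤ α * (k + 1) := by positivity
    have a1 := mul_le_mul_of_nonneg_left l1' hk
    have a2 := mul_le_mul_of_nonneg_left u1' hk
    have a3 := mul_le_mul_of_nonneg_left l2 hk'
    have a4 := mul_le_mul_of_nonneg_left u2 hk'
    rw [abs_le]
    constructor <;> nlinarith
  have e1 : (k + 2) * ∑ i ∈ Finset.range N, (gridUpper N i ^ (k + 1) - gridLower α N i ^ (k + 1)) -
      α * (k + 1) = ∑ i ∈ Finset.range N,
        ((k + 2) * (gridUpper N i ^ (k + 1) - gridLower α N i ^ (k + 1)) -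
        α * (k + 1) * (((i + 1 : ℕ) * h) ^ (k + 2) - (i * h) ^ (k + 2))) := by
    conv_rhs => rw [Finset.sum_sub_distrib, ← Finset.mul_sum, ← Finset.mul_sum, htel (k + 2) (by omega), mul_one]
  rw [e1]
  refine (Finset.abs_sum_le_sum_abs _ _).trans ((Finset.sum_le_sum hterm).trans_eq ?_)
  rw [← Finset.mul_sum, htel (k + 1) (by omega), mul_one]

theorem tendsto_sum_grid {α : ℝ} (h0 : 0 ≤ α) (h1 : α ≤ 1) (k : ℕ) :
    Tendsto (fun N : ℕ => ∑ i ∈ Finset.range N,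
      (gridUpper N i ^ (k + 1) - gridLower α N i ^ (k + 1))) atTop
      (𝓝 (α * ((k + 1) / (k + 2)))) := by
  have hlim : Tendsto (fun N : ℕ => ((k + 2) * (k + 1) * α * (1 / N) : ℝ)) atTop (𝓝 0) := by
    simpa using (tendsto_one_div_atTop_nhds_zero_nat (𝕜 := ℝ)).const_mul ((k + 2) * (k + 1) * α)
  have h := squeeze_zero_norm' (f := fun N : ℕ => (k + 2) * ∑ i ∈ Finset.range N,
    (gridUpper N i ^ (k + 1) - gridLower α N i ^ (k + 1)) - α * (k + 1)) (by
    filter_upwards [eventually_gt_atTop 0] with N hN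
    exact abs_sum_grid_sub_le h0 h1 hN k) hlim
  have h2 := (h.add_const (α * (k + 1))).const_mul ((k + 2 : ℝ)⁻¹)
  have hk : (k + 2 : ℝ) ≠ 0 := by positivity
  convert! h2 using 2
  · rw [sub_add_cancel, inv_mul_cancel_left₀ hk]
  · field_simp
    ring

theorem tendsto_coeff_ratioProd_grid {α : ℝ} (h0 : 0 ≤ α) (h1 : α ≤ 1) (n : ℕ) :
    Tendsto (fun N : ℕ => PowerSeries.coeff n (ratioProd (gridLower α N) (gridUpper N) N)) atTop
      (𝓝 (bmpP α n)) := by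
  induction n using Nat.strong_induction_on with
  | _ n ih =>
    rcases n with _ | n
    · simp [coeff_ratioProd_zero, bmpP_zero, -PowerSeries.coeff_zero_eq_constantCoeff]
    simp only [coeff_ratioProd_succ]
    rw [bmpP_succ, show α / ((n : ℝ) + 1) = 1 / ((n : ℝ) + 1) * α by ring, mul_assoc, Finset.mul_sum]
    refine (tendsto_finsetSum _ fun k hk => ?_).const_mul _
    rw [← mul_assoc]
    exact (tendsto_sum_grid h0 h1 k).mul (ih _ (by omega))

theorem exists_finiteMeasure_ratioProd_grid {α : ℝ} (h0 : 0 ≤ α) (h1 : α ≤ 1) (N : ℕ) :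
    ∃ μ : FiniteMeasure unitInterval, ∀ n : ℕ, ∫ x, (x : ℝ) ^ n ∂(μ : Measure unitInterval) =
      PowerSeries.coeff (n + 1) (ratioProd (gridLower α N) (gridUpper N) N) := by
  rcases N.eq_zero_or_pos with rfl | hN
  · exact ⟨0, fun n => by simp [ratioProd, PowerSeries.coeff_one]⟩
  have hN' : (0 : ℝ) < N := by exact_mod_cast hN
  obtain ⟨c, hc, heq⟩ := exists_ratioProd_eq (a := gridLower α N) (b := gridUpper N) (n := N)
    (fun i _ => sub_le_self _ (by positivity)) (fun i hi j hj => by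
      have hi' : (i : ℝ) ≤ N := by exact_mod_cast hi.le
      have hj' : (j : ℝ) + 1 ≤ i := by exact_mod_cast hj
      have h : α * i / N ≤ 1 := by
        rw [div_le_one hN']
        nlinarith
      calc gridUpper N j ≤ i / N := by rw [gridUpper]; gcongr
        _ = (i + 1) / N - 1 * (1 / N) := by ring
        _ ≤ gridLower α N i := by rw [gridLower]; gcongr)
    (fun i j hij => by
      have : (i : ℝ) < j := by exact_mod_cast hij
      simp only [gridUpper]
      gcongr)
  obtain ⟨μ, hμ⟩ := exists_finiteMeasure_integral_pow_eq_sum (c := c) (b := gridUpper N)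
    (Finset.range N) (fun i _ => hc i) (fun i hi => by
      have : (i : ℝ) + 1 ≤ N := by exact_mod_cast Finset.mem_range.1 hi
      exact ⟨by rw [gridUpper]; positivity, by rw [gridUpper]; exact (div_le_one hN').2 this⟩)
  refine ⟨μ, fun n => ?_⟩
  rw [hμ, heq, map_add, PowerSeries.coeff_succ_X_mul]
  simp [PowerSeries.coeff_one, geomSeries]

theorem exists_finiteMeasure_bmpP {α : ℝ} (h0 : 0 ≤ α) (h1 : α ≤ 1) :
    ∃ μ : FiniteMeasure unitInterval, ∀ n : ℕ,
      ∫ x, (x : ℝ) ^ n ∂(μ : Measure unitInterval) = bmpP α (n + 1) :=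
  exists_finiteMeasure_of_tendsto_moments (exists_finiteMeasure_ratioProd_grid h0 h1)
    fun n => tendsto_coeff_ratioProd_grid h0 h1 (n + 1)

theorem isStieltjesMoment_bmpP {α : ℝ} (h0 : 0 ≤ α) (h1 : α ≤ 1) :
    IsStieltjesMoment fun n => bmpP α (n + 1) := by
  obtain ⟨μ, hμ⟩ := exists_finiteMeasure_bmpP h0 h1
  refine ⟨(μ : Measure unitInterval).map Subtype.val, ?_, fun n => ⟨?_, ?_⟩⟩
  · rw [Measure.map_apply measurable_subtype_coe measurableSet_Iio]
    convert! measure_empty (μ := (μ : Measure unitInterval))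
    ext x
    simpa using x.2.1
  · rw [integrable_map_measure (by fun_prop) (by fun_prop)]
    exact (by fun_prop : Continuous fun x : unitInterval => (x : ℝ) ^ n).integrable_of_hasCompactSupport
      (HasCompactSupport.of_compactSpace _)
  · rw [integral_map (by fun_prop) (by fun_prop), hμ]

theorem measure_compl_Icc_eq_zero_of_moments {s : ℕ → ℝ} {σ : Measure ℝ} (hσ : σ (Iio 0) = 0)
    (hmom : ∀ n : ℕ, Integrable (fun x : ℝ => x ^ n) σ ∧ s n = ∫ x, x ^ n ∂σ)
    (hs : ∀ ρ, 1 < ρ → ∃ C, ∀ n, s n ≤ C * ρ ^ n) : σ (Icc 0 1)ᶜ = 0 := by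
  have hae : ∀ᵐ x ∂σ, 0 ≤ x := by
    rw [ae_iff]
    simpa [Iio] using hσ
  have : IsFiniteMeasure σ := by
    have := (hmom 0).1
    simp only [pow_zero] at this
    exact (integrable_const_iff_isFiniteMeasure one_ne_zero).1 this
  have hIci : ∀ M, 1 < M → σ (Ici M) = 0 := by
    intro M hM
    obtain ⟨ρ, hρ1, hρM⟩ := exists_between hM
    obtain ⟨C, hC⟩ := hs ρ hρ1
    have hρ0 : 0 < ρ := by linarith
    have hbound : ∀ n : ℕ, σ.real (Ici M) * (M / ρ) ^ n ≤ C := by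
      intro n
      have h1 : ∫ x, (Ici M).indicator (fun _ => M ^ n) x ∂σ ≤ ∫ x, x ^ n ∂σ := by
        refine integral_mono_ae ((integrable_const _).indicator measurableSet_Ici) (hmom n).1 ?_
        filter_upwards [hae] with x hx
        by_cases hxM : x ∈ Ici M
        · rw [indicator_of_mem hxM]
          exact pow_le_pow_left₀ (by linarith) hxM n
        · rw [indicator_of_notMem hxM]
          positivity
      rw [integral_indicator_const _ measurableSet_Ici, smul_eq_mul, ← (hmom n).2] at h1
      rw [div_pow, ← mul_div_assoc, div_le_iff₀ (by positivity)]
      exact h1.trans (hC n)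
    by_contra hne
    have hpos : 0 < σ.real (Ici M) := ENNReal.toReal_pos hne (measure_ne_top _ _)
    obtain ⟨n, hn⟩ := pow_unbounded_of_one_lt (C / σ.real (Ici M)) ((one_lt_div hρ0).2 hρM)
    rw [div_lt_iff₀ hpos, mul_comm] at hn
    exact (hbound n).not_gt hn
  have hsub : (Icc (0 : ℝ) 1)ᶜ ⊆ Iio 0 ∪ ⋃ n : ℕ, Ici (1 + 1 / ((n : ℝ) + 1)) := by
    intro x hx
    rcases lt_or_ge x 0 with h | h
    · exact Or.inl h
    · have hx1 : 1 < x := by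
        by_contra! hle
        exact hx ⟨h, hle⟩
      obtain ⟨n, hn⟩ := exists_nat_one_div_lt (sub_pos.2 hx1)
      exact Or.inr (mem_iUnion.2 ⟨n, by simp only [mem_Ici]; linarith⟩)
  refine measure_mono_null hsub (measure_union_null hσ (measure_iUnion_null fun n => hIci _ ?_))
  have : (0 : ℝ) < 1 / ((n : ℝ) + 1) := by positivity
  linarith

theorem exists_abs_bmpP_shift_le (α : ℝ) (n : ℕ) {ρ : ℝ} (hρ : 1 < ρ) :
    ∃ C, ∀ k, |bmpP α (n + k + 1)| ≤ C * ρ ^ k := by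
  obtain ⟨C, -, hC⟩ := exists_abs_bmpP_le_geometric α hρ
  refine ⟨C * ρ ^ (n + 1), fun k => (hC _).trans_eq ?_⟩
  ring

theorem hasDerivAt_altExp_bmpP (α : ℝ) (n : ℕ) (s : ℝ) :
    HasDerivAt (altExp fun k => bmpP α (n + k + 1))
      (-altExp (fun k => bmpP α (n + 1 + k + 1)) s) s := by
  obtain ⟨C, hC⟩ := exists_abs_bmpP_shift_le α n one_lt_two
  convert! hasDerivAt_altExp hC s using 5
  ring_nf

theorem completelyMonotonicOn_bmpPhiR_iff (α : ℝ) :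
    CompletelyMonotonicOn (fun s => bmpPhiR α s) ↔
      ∀ n s, 0 < s → 0 ≤ altExp (fun k => bmpP α (n + k + 1)) s := by
  rw [← completelyMonotonicOn_const_mul_iff (hasDerivAt_altExp_bmpP α) (Real.exp_pos α)]
  simp [bmpPhiR, altExp]

theorem completelyMonotonicOn_bmpPhiR_of_isStieltjesMoment {α : ℝ}
    (h : IsStieltjesMoment fun n => bmpP α (n + 1)) :
    CompletelyMonotonicOn (fun s => bmpPhiR α s) := by
  rw [completelyMonotonicOn_bmpPhiR_iff]
  obtain ⟨σ, hσ, hmom⟩ := h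
  intro n s hs
  have hae : ∀ᵐ x ∂σ, 0 ≤ x := by
    rw [ae_iff]
    simpa [Iio] using hσ
  obtain ⟨C, hC⟩ := exists_abs_bmpP_shift_le α n one_lt_two
  let F : ℕ → ℝ → ℝ := fun k x => (-1) ^ k * s ^ k / k.factorial * x ^ (n + k)
  have hF : ∀ k, Integrable (F k) σ := fun k => (hmom (n + k)).1.const_mul _
  have hFint : ∀ k, ∫ x, F k x ∂σ = (-1) ^ k * bmpP α (n + k + 1) * s ^ k / k.factorial := by
    intro k
    rw [integral_const_mul, ← (hmom (n + k)).2]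
    ring
  have hnorm : ∀ k, ∫ x, ‖F k x‖ ∂σ = bmpP α (n + k + 1) * s ^ k / k.factorial := by
    intro k
    have : (fun x => ‖F k x‖) =ᵐ[σ] fun x => s ^ k / k.factorial * x ^ (n + k) := by
      filter_upwards [hae] with x hx
      simp only [F]
      rw [norm_mul, norm_div, norm_mul, norm_pow, norm_neg, norm_one, one_pow, one_mul,
        Real.norm_of_nonneg (by positivity), Real.norm_of_nonneg (by positivity),
        Real.norm_of_nonneg (by positivity)]
    rw [integral_congr_ae this, integral_const_mul, ← (hmom (n + k)).2]
    ring
  have hsum : Summable fun k => ∫ x, ‖F k x‖ ∂σ := by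
    refine .of_norm_bounded (summable_geometric_mul_pow_div_factorial C 2 |s|) fun k => ?_
    rw [hnorm]
    convert! abs_altExp_term_le hC s k using 1
    simp
  have hasSum_int := hasSum_integral_of_summable_integral_norm hF hsum
  simp only [hFint] at hasSum_int
  rw [altExp, hasSum_int.tsum_eq]
  refine integral_nonneg_of_ae ?_
  filter_upwards [hae] with x hx
  have hx' : ∑' k, F k x = x ^ n * Real.exp (-(s * x)) := by
    rw [Real.exp_eq_exp_ℝ, ← (NormedSpace.expSeries_div_hasSum_exp (-(s * x))).tsum_eq,
      ← tsum_mul_left]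
    refine tsum_congr fun k => ?_
    simp only [F]
    rw [neg_pow (s * x), mul_pow s x, pow_add]
    ring
  rw [Pi.zero_apply, hx']
  positivity

theorem mem_Icc_of_completelyMonotonicOn_bmpPhiR {α : ℝ}
    (h : CompletelyMonotonicOn (fun s => bmpPhiR α s)) : 0 ≤ α ∧ α ≤ 1 := by
  rw [completelyMonotonicOn_bmpPhiR_iff] at h
  let G : ℕ → ℝ → ℝ := fun n => altExp fun k => bmpP α (n + k + 1)
  have hG : ∀ n s, HasDerivAt (G n) (-G (n + 1) s) s := hasDerivAt_altExp_bmpP α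
  have hG0 : ∀ n, G n 0 = bmpP α (n + 1) := fun n => altExp_zero _
  have hp : ∀ n, 0 ≤ bmpP α (n + 1) := by
    intro n
    rw [← hG0]
    have hc : Tendsto (G n) (𝓝[>] 0) (𝓝 (G n 0)) :=
      (hG n 0).continuousAt.tendsto.mono_left nhdsWithin_le_nhds
    refine ge_of_tendsto hc ?_
    filter_upwards [self_mem_nhdsWithin] with s hs using h n s hs
  have hpos : ∀ n s, 0 ≤ G n s := by
    intro n s
    rcases lt_or_ge 0 s with hs | hs
    · exact h n s hs
    · refine tsum_nonneg fun k => ?_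
      rw [mul_right_comm, ← mul_pow]
      have := hp (n + k)
      have : 0 ≤ -1 * s := by linarith
      positivity
  have hα : 0 ≤ α := by
    have := hp 0
    rw [zero_add, bmpP_one] at this
    linarith
  refine ⟨hα, ?_⟩
  rcases hα.eq_or_lt with rfl | hα
  · exact zero_le_one
  refine le_one_of_bmpP_antitone hα fun n => ?_
  have hstep : ∀ ρ, 1 < ρ → bmpP α (n + 2) ≤ ρ * bmpP α (n + 1) := by
    intro ρ hρ
    obtain ⟨C, hC⟩ := exists_abs_bmpP_shift_le α n hρ
    have := le_mul_of_completelyMonotone_of_exp_bound (G := fun m => G (n + m)) (C := C) (ρ := ρ)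
      (fun m s => hG (n + m) s) (fun m s => hpos _ s) (fun s => altExp_le hC s)
    simpa only [hG0, add_zero] using this
  have hlim : Tendsto (fun ρ => ρ * bmpP α (n + 1)) (𝓝[>] 1) (𝓝 (1 * bmpP α (n + 1))) :=
    (continuous_id.mul_const _).continuousAt.tendsto.mono_left nhdsWithin_le_nhds
  rw [one_mul] at hlim
  refine ge_of_tendsto hlim ?_
  filter_upwards [self_mem_nhdsWithin] with ρ hρ using hstep ρ hρ

/-- `(p_{n+1}(α))` is a Stieltjes moment sequence ⟺ `φ_α` is completely monotonic ⟺
`0 ≤ α ≤ 1`; in that case any representing measure is supported by `[0,1]`. -/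
theorem stmt11 (α : ℝ) :
    (IsStieltjesMoment (fun n => bmpP α (n + 1)) ↔
      CompletelyMonotonicOn (fun s => bmpPhiR α s)) ∧
    (IsStieltjesMoment (fun n => bmpP α (n + 1)) ↔ 0 ≤ α ∧ α ≤ 1) ∧
    ((0 ≤ α ∧ α ≤ 1) → ∀ σ : MeasureTheory.Measure ℝ,
      (σ (Set.Iio 0) = 0 ∧ ∀ n : ℕ, MeasureTheory.Integrable (fun x : ℝ => x ^ n) σ ∧
        bmpP α (n + 1) = ∫ x, x ^ n ∂σ) →
      σ (Set.Icc 0 1)ᶜ = 0) := by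
  refine ⟨⟨completelyMonotonicOn_bmpPhiR_of_isStieltjesMoment, fun h =>
      (mem_Icc_of_completelyMonotonicOn_bmpPhiR h).elim isStieltjesMoment_bmpP⟩,
    ⟨fun h => mem_Icc_of_completelyMonotonicOn_bmpPhiR
      (completelyMonotonicOn_bmpPhiR_of_isStieltjesMoment h),
      fun h => isStieltjesMoment_bmpP h.1 h.2⟩,
    fun _ σ hσ => measure_compl_Icc_eq_zero_of_moments (s := fun n => bmpP α (n + 1)) hσ.1 hσ.2
      fun ρ hρ => ?_⟩
  obtain ⟨C, hC⟩ := exists_abs_bmpP_shift_le α 0 hρ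
  exact ⟨C, fun n => by simpa using (le_abs_self _).trans (hC n)⟩
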